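/- Assume the data (V, a, α, p₀, p₁, λ) forms an admissible spectral curve which is in addition symmetric, meaning V′(−z) = −V′(z), p₁(−z) = p₁(z), and p₀(−z) = −p₀(z) for all z (equivalently, F(−ξ, −z) = −F(ξ, z) for F(ξ,z) = ξ³ − V′(z)ξ² + p₁(z)ξ + p₀(z)). Then m is even, V is an even polynomial, α = 1/2, the Cauchy transform satisfies C^λ(−z) = −C^λ(z) for every z ∈ ℂ∖ℝ, and λ is invariant under the reflection x ↦ −x. -/

import Mathlib

open MeasureTheory Polynomial

noncomputable section

/-- The Cauchy transform `C^λ(z) = ∫ dλ(s)/(s − z)` of a measure on `ℝ`. -/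
def cauchyT (lam : Measure ℝ) (z : ℂ) : ℂ := ∫ s : ℝ, ((s : ℂ) - z)⁻¹ ∂lam

/-- The solution `ξ₁(z) = C^λ(z) + V′(z)`. -/
def xi1 (V : Polynomial ℝ) (lam : Measure ℝ) (z : ℂ) : ℂ :=
  cauchyT lam z + Polynomial.aeval z V.derivative

/-- The coefficient `v_k` in `V(z) = ∑_{k=1}^m (v_k/k) z^k`, i.e. `v_k = k·(coeff of z^k)`. -/
def vcoef (V : Polynomial ℝ) (k : ℕ) : ℝ := (k : ℝ) * V.coeff k

/-- An **admissible spectral curve**: an irreducible real cubic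
`ξ³ − V′(z)ξ² + p₁(z)ξ + p₀(z) = 0` with `deg p₁ ≤ m−2`,
`p₀(z) = v_m a² z^{m−1} + (v_{m−1}a² + v_m a(2α−1)) z^{m−2} + …`, one of whose
solutions is `ξ₁(z) = C^λ(z) + V′(z)` for a probability measure `λ` on `ℝ`. -/
structure AdmissibleSpectralCurve (V : Polynomial ℝ) (a α : ℝ) (p₀ p₁ : Polynomial ℝ)
    (lam : Measure ℝ) : Prop where
  hdeg : 2 ≤ V.natDegree
  hconst : V.coeff 0 = 0
  ha : 0 < a
  halpha0 : 0 < α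
  halpha1 : α < 1
  hirr : Irreducible (Polynomial.X ^ 3 + Polynomial.C (-V.derivative) * Polynomial.X ^ 2
    + Polynomial.C p₁ * Polynomial.X + Polynomial.C p₀ : Polynomial (Polynomial ℝ))
  hp₁ : p₁.degree ≤ ((V.natDegree - 2 : ℕ) : WithBot ℕ)
  hp₀deg : p₀.natDegree ≤ V.natDegree - 1
  hp₀top : p₀.coeff (V.natDegree - 1) = vcoef V V.natDegree * a ^ 2
  hp₀next : p₀.coeff (V.natDegree - 2)
    = vcoef V (V.natDegree - 1) * a ^ 2 + vcoef V V.natDegree * a * (2 * α - 1)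
  hprob : IsProbabilityMeasure lam
  hsol : ∀ z : ℂ, z.im ≠ 0 →
    xi1 V lam z ^ 3 - Polynomial.aeval z V.derivative * xi1 V lam z ^ 2
      + Polynomial.aeval z p₁ * xi1 V lam z + Polynomial.aeval z p₀ = 0

theorem norm_inv_ofReal_sub_le (s : ℝ) {z : ℂ} (hz : z.im ≠ 0) :
    ‖((s : ℂ) - z)⁻¹‖ ≤ |z.im|⁻¹ := by
  rw [norm_inv]
  refine inv_anti₀ (abs_pos.mpr hz) ?_
  simpa using Complex.abs_im_le_norm ((s : ℂ) - z)

theorem integrable_inv_ofReal_sub (μ : Measure ℝ) [IsFiniteMeasure μ] {z : ℂ} (hz : z.im ≠ 0) :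
    Integrable (fun s : ℝ => ((s : ℂ) - z)⁻¹) μ :=
  Integrable.of_bound (by fun_prop) _ (ae_of_all _ fun s => norm_inv_ofReal_sub_le s hz)

theorem norm_cauchyT_le (μ : Measure ℝ) [IsProbabilityMeasure μ] {z : ℂ} (hz : z.im ≠ 0) :
    ‖cauchyT μ z‖ ≤ |z.im|⁻¹ := by
  simpa [cauchyT] using
    norm_integral_le_of_norm_le_const (μ := μ) (ae_of_all _ fun s => norm_inv_ofReal_sub_le s hz)

theorem differentiableAt_cauchyT (μ : Measure ℝ) [IsFiniteMeasure μ] {z : ℂ} (hz : z.im ≠ 0) :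
    DifferentiableAt ℂ (cauchyT μ) z := by
  have hT : cauchyT μ = resolventTransform μ := by
    ext w
    simp [cauchyT, resolventTransform_apply, resolvent]
  rw [hT]
  refine (hasDerivAt_resolventTransform z ?_).differentiableAt
  rintro ⟨x, -, rfl⟩
  simp at hz

theorem cauchyT_map_neg (μ : Measure ℝ) (z : ℂ) :
    cauchyT (μ.map fun x : ℝ => -x) z = -cauchyT μ (-z) := by
  unfold cauchyT
  rw [integral_map (by fun_prop) (by fun_prop), ← integral_neg]
  congr 1 with s
  rw [← inv_neg]
  push_cast
  ring_nf

/-- The integral of `f (s + y t) / (1 + t²)` against `μ ⊗ dt` is an integral against the imaginary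
part of the Cauchy transform on the line `Im z = y`. -/
theorem integral_prod_poisson (μ : Measure ℝ) [IsFiniteMeasure μ] (f : BoundedContinuousFunction ℝ ℝ)
    {y : ℝ} (hy : 0 < y) :
    ∫ p : ℝ × ℝ, f (p.1 + y * p.2) * (1 + p.2 ^ 2)⁻¹ ∂(μ.prod volume) =
      ∫ x : ℝ, f x * (cauchyT μ (x + y * Complex.I)).im := by
  have hbase : Integrable (fun p : ℝ × ℝ => (1 : ℝ) * (1 + p.2 ^ 2)⁻¹) (μ.prod volume) :=
    (integrable_const (μ := μ) (1 : ℝ)).mul_prod integrable_inv_one_add_sq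
  have hfint : Integrable (fun p : ℝ × ℝ => f (p.1 + y * p.2) * (1 + p.2 ^ 2)⁻¹)
      (μ.prod volume) := by
    simp only [one_mul] at hbase
    exact hbase.bdd_mul (c := ‖f‖) (by fun_prop) (ae_of_all _ fun p => f.norm_coe_le_norm _)
  have hg : Integrable (fun u : ℝ => y⁻¹ * (1 + (u / y) ^ 2)⁻¹) :=
    (integrable_inv_one_add_sq.comp_div hy.ne').const_mul _
  have hconv : Integrable (fun p : ℝ × ℝ => (1 : ℝ) * (y⁻¹ * (1 + ((p.1 - p.2) / y) ^ 2)⁻¹))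
      (volume.prod μ) :=
    (integrable_const (μ := μ) (1 : ℝ)).convolution_integrand (ContinuousLinearMap.mul ℝ ℝ) hg
  have hconv' : Integrable (fun p : ℝ × ℝ => f p.1 * (y⁻¹ * (1 + ((p.1 - p.2) / y) ^ 2)⁻¹))
      (volume.prod μ) := by
    simp only [one_mul] at hconv
    exact hconv.bdd_mul (c := ‖f‖) (by fun_prop) (ae_of_all _ fun p => f.norm_coe_le_norm _)
  have hinner (s : ℝ) : ∫ t : ℝ, f (s + y * t) * (1 + t ^ 2)⁻¹ =
      ∫ x : ℝ, f x * (y⁻¹ * (1 + ((x - s) / y) ^ 2)⁻¹) := by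
    have h1 := integral_add_right_eq_self (μ := (volume : Measure ℝ))
      (fun x : ℝ => f x * (y⁻¹ * (1 + ((x - s) / y) ^ 2)⁻¹)) s
    have h2 := Measure.integral_comp_mul_left
      (fun x : ℝ => f (x + s) * (y⁻¹ * (1 + ((x + s - s) / y) ^ 2)⁻¹)) y
    rw [h1, abs_of_pos (inv_pos.mpr hy), smul_eq_mul, inv_mul_eq_div, eq_div_iff hy.ne'] at h2
    rw [← h2, ← integral_mul_const]
    congr 1 with t
    rw [add_sub_cancel_right, mul_div_cancel_left₀ _ hy.ne', add_comm s]
    field_simp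
  have him (x : ℝ) : ∫ s : ℝ, f x * (y⁻¹ * (1 + ((x - s) / y) ^ 2)⁻¹) ∂μ =
      f x * (cauchyT μ (x + y * Complex.I)).im := by
    have hz : ((x : ℂ) + y * Complex.I).im ≠ 0 := by simpa using hy.ne'
    have h1 := integral_im (𝕜 := ℂ) (integrable_inv_ofReal_sub μ hz)
    rw [integral_const_mul, cauchyT]
    congr 1
    refine Eq.trans ?_ h1
    congr 1 with s
    simp only [RCLike.im_to_complex, Complex.inv_im, Complex.normSq_apply]
    simp
    have h3 : (s - x) * (s - x) + y * y ≠ 0 :=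
      (add_pos_of_nonneg_of_pos (mul_self_nonneg _) (mul_pos hy hy)).ne'
    field_simp
    ring
  rw [integral_prod _ hfint]
  simp only [hinner]
  rw [← integral_integral_swap (f := fun x s : ℝ => f x * (y⁻¹ * (1 + ((x - s) / y) ^ 2)⁻¹)) hconv']
  simp only [him]

open Filter Topology in
theorem tendsto_integral_prod_poisson (μ : Measure ℝ) [IsFiniteMeasure μ]
    (f : BoundedContinuousFunction ℝ ℝ) :
    Tendsto (fun y : ℝ => ∫ p : ℝ × ℝ, f (p.1 + y * p.2) * (1 + p.2 ^ 2)⁻¹ ∂(μ.prod volume))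
      (𝓝[>] 0) (𝓝 ((∫ s, f s ∂μ) * Real.pi)) := by
  rw [← integral_univ_inv_one_add_sq, ← integral_prod_mul]
  have hbase : Integrable (fun p : ℝ × ℝ => ‖f‖ * (1 + p.2 ^ 2)⁻¹) (μ.prod volume) :=
    (integrable_const (μ := μ) ‖f‖).mul_prod integrable_inv_one_add_sq
  refine tendsto_integral_filter_of_dominated_convergence _ (Eventually.of_forall fun y => ?_)
    (Eventually.of_forall fun y => ae_of_all _ fun p => ?_) hbase (ae_of_all _ fun p => ?_)
  · have : Continuous fun p : ℝ × ℝ => (1 + p.2 ^ 2)⁻¹ :=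
      Continuous.inv₀ (by fun_prop) fun p => by positivity
    exact Continuous.aestronglyMeasurable (by fun_prop)
  · rw [norm_mul, Real.norm_of_nonneg (r := (1 + p.2 ^ 2)⁻¹) (by positivity)]
    gcongr
    exact f.norm_coe_le_norm _
  · refine tendsto_nhdsWithin_of_tendsto_nhds ?_
    refine Tendsto.mul_const _ ?_
    have : Continuous fun y : ℝ => f (p.1 + y * p.2) := by fun_prop
    simpa using this.tendsto 0

/-- A finite measure on `ℝ` is determined by its Cauchy transform on the upper half-plane. -/
theorem measure_ext_of_cauchyT_eq {μ ν : Measure ℝ} [IsFiniteMeasure μ] [IsFiniteMeasure ν]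
    (h : ∀ z : ℂ, 0 < z.im → cauchyT μ z = cauchyT ν z) : μ = ν := by
  refine ext_of_forall_integral_eq_of_IsFiniteMeasure fun f => ?_
  refine mul_right_cancel₀ Real.pi_ne_zero
    (tendsto_nhds_unique (tendsto_integral_prod_poisson μ f) ?_)
  refine (tendsto_integral_prod_poisson ν f).congr' ?_
  filter_upwards [self_mem_nhdsWithin] with y hy
  rw [integral_prod_poisson μ f hy, integral_prod_poisson ν f hy]
  congr 1 with x
  rw [h _ (by simpa using hy)]

theorem comp_neg_X_eq_of_eval_neg {p : ℝ[X]} (h : ∀ x, p.eval (-x) = p.eval x) :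
    p.comp (-X) = p :=
  Polynomial.funext fun x => by simpa using h x

theorem comp_neg_X_eq_neg_of_eval_neg {p : ℝ[X]} (h : ∀ x, p.eval (-x) = -p.eval x) :
    p.comp (-X) = -p :=
  Polynomial.funext fun x => by simpa using h x

theorem coeff_eq_zero_of_comp_neg_X_eq_neg {p : ℝ[X]} (h : p.comp (-X) = -p) {n : ℕ}
    (hn : Even n) : p.coeff n = 0 := by
  have h1 := congrArg (fun q : ℝ[X] => q.coeff n) h
  rw [show (-X : ℝ[X]) = C (-1) * X by simp] at h1
  simp only [comp_C_mul_X_coeff, hn.neg_one_pow, mul_one, coeff_neg] at h1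
  linarith

theorem aeval_neg_eq_aeval_comp (p : ℝ[X]) (z : ℂ) : aeval (-z) p = aeval z (p.comp (-X)) := by
  simp [aeval_comp]

/-- Far from the origin, two roots `v + c` and `v + d` of `ξ³ − vξ² + pξ + q` with bounded `c`, `d`
coincide as soon as `v` is large and dominates `p`. -/
theorem eq_of_cubic_roots {v p q c d : ℂ} (hc : ‖c‖ ≤ 1) (hd : ‖d‖ ≤ 1) (hv : 7 ≤ ‖v‖)
    (hp : ‖p‖ ≤ ‖v‖)
    (h1 : (c + v) ^ 3 - v * (c + v) ^ 2 + p * (c + v) + q = 0)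
    (h2 : (d + v) ^ 3 - v * (d + v) ^ 2 + p * (d + v) + q = 0) : c = d := by
  by_contra hne
  have h3 : v ^ 2 = -(2 * v * (c + d) + (c * c + c * d + d * d) + p) := by
    have : (c - d) * (v ^ 2 + (2 * v * (c + d) + (c * c + c * d + d * d) + p)) = 0 := by
      linear_combination h1 - h2
    have := (mul_eq_zero.mp this).resolve_left (sub_ne_zero.mpr hne)
    linear_combination this
  have hcd : ‖c + d‖ ≤ 2 := (norm_add_le _ _).trans (by linarith)
  have hquad : ‖c * c + c * d + d * d‖ ≤ 3 := by
    refine (norm_add₃_le).trans ?_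
    simp only [norm_mul]
    nlinarith [norm_nonneg c, norm_nonneg d]
  have h4 : ‖v‖ ^ 2 ≤ 2 * ‖v‖ * 2 + 3 + ‖v‖ := by
    rw [← norm_pow, h3, norm_neg]
    refine (norm_add₃_le).trans ?_
    gcongr
    rw [norm_mul, norm_mul]
    gcongr
    simp
  nlinarith

open Filter Bornology in
/-- Outside a bounded set, a real polynomial of positive degree is large and dominates every
polynomial of lower degree. -/
theorem exists_radius_norm_aeval {p v : ℝ[X]} (hv : 0 < v.degree) (hpv : p.degree < v.degree)
    (B : ℝ) : ∃ R : ℝ, ∀ z : ℂ, R ≤ ‖z‖ → B ≤ ‖aeval z v‖ ∧ ‖aeval z p‖ ≤ ‖aeval z v‖ := by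
  have h1 : ∀ᶠ z in cobounded ℂ, B ≤ ‖(v.map (algebraMap ℝ ℂ)).eval z‖ :=
    (tendsto_norm_atTop _ (by rwa [degree_map]) tendsto_norm_cobounded_atTop).eventually_ge_atTop B
  have h2 : ∀ᶠ z in cobounded ℂ, ‖(p.map (algebraMap ℝ ℂ)).eval z‖ ≤
      1 * ‖(v.map (algebraMap ℝ ℂ)).eval z‖ :=
    (isLittleO_cobounded_of_degree_lt (by rwa [degree_map, degree_map])).bound one_pos
  obtain ⟨R, -, hR⟩ := (hasBasis_cobounded_norm (E := ℂ)).eventually_iff.mp (h1.and h2)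
  refine ⟨R, fun z hz => ?_⟩
  simpa [eval_map_algebraMap] using hR hz

theorem vcoef_eq_coeff_derivative (V : ℝ[X]) {k : ℕ} (hk : 1 ≤ k) :
    vcoef V k = V.derivative.coeff (k - 1) := by
  obtain ⟨k, rfl⟩ := Nat.exists_eq_add_of_le' hk
  simp [vcoef, coeff_derivative, mul_comm]

/-- The Cauchy transform of a symmetric admissible spectral curve is odd on the upper
half-plane. -/
theorem AdmissibleSpectralCurve.cauchyT_map_neg_eq {V : ℝ[X]} {a α : ℝ} {p₀ p₁ : ℝ[X]}
    {lam : Measure ℝ} (h : AdmissibleSpectralCurve V a α p₀ p₁ lam)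
    (hV : V.derivative.comp (-X) = -V.derivative) (hp₁ : p₁.comp (-X) = p₁)
    (hp₀ : p₀.comp (-X) = -p₀) {z : ℂ} (hz : 0 < z.im) :
    cauchyT (lam.map fun x : ℝ => -x) z = cauchyT lam z := by
  have := h.hprob
  have : IsProbabilityMeasure (lam.map fun x : ℝ => -x) :=
    Measure.isProbabilityMeasure_map (by fun_prop)
  have hdeg := h.hdeg
  have hd : V.derivative.degree = ((V.natDegree - 1 : ℕ) : WithBot ℕ) :=
    degree_derivative (by omega)
  obtain ⟨R, hR⟩ := exists_radius_norm_aeval (p := p₁) (v := V.derivative)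
    (by rw [hd]; exact_mod_cast (by omega : 0 < V.natDegree - 1))
    (by
      rw [hd]
      exact h.hp₁.trans_lt (by exact_mod_cast (by omega : V.natDegree - 2 < V.natDegree - 1))) 7
  have hfar (w : ℂ) (hw : max R 1 < w.im) :
      cauchyT (lam.map fun x : ℝ => -x) w = cauchyT lam w := by
    have hw1 : 1 < w.im := (le_max_right _ _).trans_lt hw
    have hw0 : w.im ≠ 0 := by linarith
    have hwR : R ≤ ‖w‖ :=
      ((le_max_left _ _).trans hw.le).trans ((le_abs_self _).trans (Complex.abs_im_le_norm w))
    have hinv : |w.im|⁻¹ ≤ 1 := inv_le_one_of_one_le₀ (hw1.le.trans (le_abs_self _))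
    have hroot := h.hsol w hw0
    have hroot' := h.hsol (-w) (by simpa using hw0)
    simp only [xi1, aeval_neg_eq_aeval_comp, hV, hp₁, hp₀, map_neg] at hroot hroot'
    refine eq_of_cubic_roots ((norm_cauchyT_le _ hw0).trans hinv)
      ((norm_cauchyT_le _ hw0).trans hinv) (hR w hwR).1 (hR w hwR).2 ?_ hroot
    rw [cauchyT_map_neg]
    linear_combination -hroot'
  have han (μ : Measure ℝ) [IsFiniteMeasure μ] :
      AnalyticOnNhd ℂ (cauchyT μ) {w : ℂ | 0 < w.im} :=
    DifferentiableOn.analyticOnNhd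
      (fun w hw => (differentiableAt_cauchyT μ (ne_of_gt hw)).differentiableWithinAt)
      (isOpen_lt continuous_const Complex.continuous_im)
  have hz₀ : max R 1 < (((max R 1 + 1 : ℝ) : ℂ) * Complex.I).im := by simp
  refine (han _).eqOn_of_preconnected_of_eventuallyEq (han lam)
    (convex_halfSpace_im_gt 0).isPreconnected (z₀ := ((max R 1 + 1 : ℝ) : ℂ) * Complex.I) ?_ ?_ hz
  · exact (zero_lt_one.trans_le (le_max_right R 1)).trans hz₀
  · filter_upwards [(isOpen_lt continuous_const Complex.continuous_im).mem_nhds hz₀] with w hw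
    exact hfar w hw

/-- **Consequences of symmetry of the spectral curve:** `m` is even, `V` is an even
polynomial, `α = 1/2`, the Cauchy transform is odd, and `λ` is reflection invariant. -/
theorem stmt19 (V : Polynomial ℝ) (a α : ℝ) (p₀ p₁ : Polynomial ℝ) (lam : Measure ℝ)
    (h : AdmissibleSpectralCurve V a α p₀ p₁ lam)
    (hsymV : ∀ x : ℝ, V.derivative.eval (-x) = -V.derivative.eval x)
    (hsymp₁ : ∀ x : ℝ, p₁.eval (-x) = p₁.eval x)
    (hsymp₀ : ∀ x : ℝ, p₀.eval (-x) = -p₀.eval x) :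
    Even V.natDegree ∧ (∀ x : ℝ, V.eval (-x) = V.eval x) ∧ α = 1 / 2 ∧
    (∀ z : ℂ, z.im ≠ 0 → cauchyT lam (-z) = -cauchyT lam z) ∧
    Measure.map (fun x : ℝ => -x) lam = lam := by
  have := h.hprob
  have hV := comp_neg_X_eq_neg_of_eval_neg hsymV
  have hp₁ := comp_neg_X_eq_of_eval_neg hsymp₁
  have hp₀ := comp_neg_X_eq_neg_of_eval_neg hsymp₀
  have hdeg := h.hdeg
  have htop : vcoef V V.natDegree ≠ 0 := by
    have hV0 : V.leadingCoeff ≠ 0 := by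
      rw [Ne, leadingCoeff_eq_zero]
      rintro rfl
      simp at hdeg
    exact mul_ne_zero (by exact_mod_cast (by omega : V.natDegree ≠ 0)) hV0
  have heven : Even V.natDegree := by
    by_contra hodd
    rw [Nat.not_even_iff_odd] at hodd
    rw [vcoef_eq_coeff_derivative V (by omega)] at htop
    exact htop (coeff_eq_zero_of_comp_neg_X_eq_neg hV (hodd.tsub_odd odd_one))
  have hmap : lam.map (fun x : ℝ => -x) = lam :=
    have : IsFiniteMeasure (lam.map fun x : ℝ => -x) := inferInstance
    measure_ext_of_cauchyT_eq fun z hz => h.cauchyT_map_neg_eq hV hp₁ hp₀ hz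
  refine ⟨heven, ?_, ?_, fun z _ => ?_, hmap⟩
  · have hder : (V.comp (-X) - V).derivative = 0 := by
      simp [derivative_comp, hV]
    have hconst := eq_C_of_derivative_eq_zero hder
    have hc0 : (V.comp (-X) - V).coeff 0 = 0 := by
      simp [coeff_zero_eq_eval_zero]
    intro x
    have hx := congrArg (fun q : ℝ[X] => q.eval x) hconst
    simp only [hc0, map_zero, eval_zero, eval_sub, eval_comp, eval_neg, eval_X] at hx
    linarith
  · have hnext := h.hp₀next
    have hm2 : Even (V.natDegree - 2) := heven.tsub even_two
    rw [coeff_eq_zero_of_comp_neg_X_eq_neg hp₀ hm2,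
      vcoef_eq_coeff_derivative V (k := V.natDegree - 1) (by omega),
      coeff_eq_zero_of_comp_neg_X_eq_neg hV (by rwa [Nat.sub_sub])] at hnext
    have hprod : vcoef V V.natDegree * a * (2 * α - 1) = 0 := by linarith
    have := (mul_eq_zero.mp hprod).resolve_left (mul_ne_zero htop h.ha.ne')
    linarith
  · have hz := cauchyT_map_neg lam z
    rw [hmap] at hz
    rw [hz, neg_neg]
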